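/- Mertens' second theorem: there exists a constant C > 0 such that for all x ≥ 2, |Σ_{p ≤ x, p prime} 1/p − log log x − C| ≤ K/log x for an absolute constant K; equivalently Σ_{p ≤ x} 1/p = log log x + C + O(1/log x). -/

import Mathlib

open Real

/-- The sum of `log p / p` over the primes `p ≤ x`. -/
noncomputable def primeLogSum (x : ℝ) : ℝ :=
  ∑ p ∈ (Finset.Iic ⌊x⌋₊).filter Nat.Prime, log p / p

/-- The sum of `1 / p` over the primes `p ≤ x`. -/
noncomputable def primeInvSum (x : ℝ) : ℝ :=
  ∑ p ∈ (Finset.Iic ⌊x⌋₊).filter Nat.Prime, (1 : ℝ) / p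

lemma mul_log_succ_sub_log_le (m : ℕ) (hm : 0 < m) :
    (m : ℝ) * (log (m + 1) - log m) ≤ 1 := by
  have hm' : (0 : ℝ) < m := by exact_mod_cast hm
  rw [← log_div (by positivity) (by positivity)]
  have h := log_le_sub_one_of_pos (x := ((m : ℝ) + 1) / m) (by positivity)
  calc (m : ℝ) * log ((m + 1) / m) ≤ m * ((m + 1) / m - 1) := by gcongr
    _ = 1 := by field_simp; ring

lemma mul_log_succ_sub_le_log_factorial (n : ℕ) :
    (n : ℝ) * log (n + 1) - n ≤ log n.factorial := by
  induction n with
  | zero => simp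
  | succ n ih =>
    rw [Nat.factorial_succ]
    push_cast
    rw [log_mul (by positivity) (by positivity)]
    have h := mul_log_succ_sub_log_le (n + 1) n.succ_pos
    push_cast at h
    nlinarith

lemma log_factorial_eq_sum_primes (n : ℕ) :
    log n.factorial =
      ∑ p ∈ (Finset.Iic n).filter Nat.Prime, (n.factorial.factorization p : ℝ) * log p := by
  rw [log_nat_eq_sum_factorization, Finsupp.sum_of_support_subset]
  · intro p hp
    rw [Nat.support_factorization, Nat.mem_primeFactors] at hp
    simp only [Finset.mem_filter, Finset.mem_Iic]
    exact ⟨(hp.1.dvd_factorial).1 hp.2.1, hp.1⟩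
  · simp

lemma sum_log_div_mul_pred_le_of_four_le (n : ℕ) (hn : 4 ≤ n) :
    ∑ p ∈ (Finset.Iic n).filter Nat.Prime, log p / (p * (p - 1)) ≤
      log 2 / 2 + log 3 / 6 + (log 5 + 1) / 4 - (log (n + 1) + 1) / n := by
  induction n, hn using Nat.le_induction with
  | base =>
    have : (Finset.Iic 4).filter Nat.Prime = {2, 3} := by decide
    rw [this]
    norm_num
  | succ n hn ih =>
    have hn' : (0 : ℝ) < n := by positivity
    have hle : ∑ p ∈ (Finset.Iic (n + 1)).filter Nat.Prime, log p / ((p : ℝ) * (p - 1)) ≤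
        ∑ p ∈ (Finset.Iic n).filter Nat.Prime, log p / ((p : ℝ) * (p - 1)) +
          log (n + 1) / ((n + 1) * n) := by
      have : Finset.Iic (n + 1) = insert (n + 1) (Finset.Iic n) := by
        ext; simp; omega
      rw [this, Finset.filter_insert]
      split_ifs with h
      · rw [Finset.sum_insert (by simp)]
        push_cast
        rw [add_sub_cancel_right]
        linarith
      · have : 0 ≤ log ((n : ℝ) + 1) / ((n + 1) * n) :=
          div_nonneg (log_nonneg (by linarith)) (by positivity)
        linarith
    have h := mul_log_succ_sub_log_le (n + 1) n.succ_pos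
    push_cast at h ⊢
    have hmono : log ((n : ℝ) + 1) ≤ log (n + 1 + 1) := log_le_log (by positivity) (by linarith)
    have key : log ((n : ℝ) + 1) / ((n + 1) * n) ≤
        (log (n + 1) + 1) / n - (log (n + 1 + 1) + 1) / (n + 1) := by
      rw [div_sub_div _ _ (by positivity) (by positivity),
        div_le_div_iff₀ (by positivity) (by positivity)]
      have : log ((n : ℝ) + 1) ≤
          (log (n + 1) + 1) * (n + 1) - n * (log (n + 1 + 1) + 1) := by nlinarith
      linarith [mul_le_mul_of_nonneg_right this (by positivity : (0 : ℝ) ≤ n * (n + 1))]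
    linarith

lemma log_le_of_pow_le {x : ℝ} (hx : 0 < x) (a b : ℕ) (hb : 0 < b)
    (h : x ^ b ≤ (2.7182 : ℝ) ^ a) : log x ≤ a / b := by
  have hb' : (0 : ℝ) < b := by exact_mod_cast hb
  rw [le_div_iff₀ hb', mul_comm, ← log_pow, log_le_iff_le_exp (by positivity),
    ← exp_one_pow]
  refine h.trans ?_
  gcongr
  exact (lt_trans (by norm_num) exp_one_gt_d9).le

lemma sum_log_div_mul_pred_le (n : ℕ) :
    ∑ p ∈ (Finset.Iic n).filter Nat.Prime, log p / ((p : ℝ) * (p - 1)) ≤ 6 / 5 := by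
  have hsub : (Finset.Iic n).filter Nat.Prime ⊆ (Finset.Iic (max n 4)).filter Nat.Prime :=
    Finset.filter_subset_filter _ (Finset.Iic_subset_Iic.2 (le_max_left _ _))
  have h1 : ∑ p ∈ (Finset.Iic n).filter Nat.Prime, log p / ((p : ℝ) * (p - 1)) ≤
      ∑ p ∈ (Finset.Iic (max n 4)).filter Nat.Prime, log p / ((p : ℝ) * (p - 1)) := by
    refine Finset.sum_le_sum_of_subset_of_nonneg hsub fun p hp _ => ?_
    have hp1 : (1 : ℝ) ≤ p := by exact_mod_cast (Finset.mem_filter.1 hp).2.one_le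
    exact div_nonneg (log_nonneg hp1) (mul_nonneg (by linarith) (by linarith))
  have h2 := sum_log_div_mul_pred_le_of_four_le (max n 4) (le_max_right _ _)
  have h3 : 0 ≤ (log (((max n 4 : ℕ) : ℝ) + 1) + 1) / ((max n 4 : ℕ) : ℝ) := by
    have : 0 ≤ log (((max n 4 : ℕ) : ℝ) + 1) := log_nonneg (by simp)
    positivity
  have l2 := log_two_lt_d9
  have l3 : log 3 ≤ (11 : ℕ) / (10 : ℕ) :=
    log_le_of_pow_le (by norm_num) _ _ (by norm_num) (by norm_num)
  have l5 : log 5 ≤ (161 : ℕ) / (100 : ℕ) :=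
    log_le_of_pow_le (by norm_num) _ _ (by norm_num) (by norm_num)
  norm_num at l3 l5
  linarith

/-- The lower bound in Mertens' first theorem. -/
lemma log_sub_le_primeLogSum {x : ℝ} (hx : 1 ≤ x) : log x - 11 / 5 ≤ primeLogSum x := by
  set n := ⌊x⌋₊ with hn
  have hn1 : 1 ≤ n := Nat.one_le_floor_iff x |>.2 hx
  have hn0 : (0 : ℝ) < n := by exact_mod_cast hn1
  have hlog : log x ≤ log (n + 1) := log_le_log (by linarith) (Nat.lt_floor_add_one x).le
  have hfac := mul_log_succ_sub_le_log_factorial n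
  have hup : log n.factorial ≤ n * (primeLogSum x +
      ∑ p ∈ (Finset.Iic n).filter Nat.Prime, log p / ((p : ℝ) * (p - 1))) := by
    rw [log_factorial_eq_sum_primes, primeLogSum, ← hn, ← Finset.sum_add_distrib, Finset.mul_sum]
    refine Finset.sum_le_sum fun p hp => ?_
    have hp := (Finset.mem_filter.1 hp).2
    have hp2 : (2 : ℝ) ≤ p := by exact_mod_cast hp.two_le
    have hp1 : (0 : ℝ) < p - 1 := by linarith
    have hv : (n.factorial.factorization p : ℝ) ≤ n / (p - 1) := by
      calc (n.factorial.factorization p : ℝ) ≤ ((n / (p - 1) : ℕ) : ℝ) := by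
            exact_mod_cast Nat.factorization_factorial_le_div_pred hp n
        _ ≤ n / ((p - 1 : ℕ) : ℝ) := Nat.cast_div_le
        _ = n / (p - 1) := by rw [Nat.cast_sub hp.one_le, Nat.cast_one]
    calc _ ≤ n / (p - 1) * log p := by
          gcongr
      _ = _ := by field_simp; ring
  have hD := sum_log_div_mul_pred_le n
  have : (n : ℝ) * (log (n + 1) - 1) ≤ n * (primeLogSum x + 6 / 5) := by
    calc (n : ℝ) * (log (n + 1) - 1) = n * log (n + 1) - n := by ring
      _ ≤ _ := hfac
      _ ≤ _ := hup
      _ ≤ _ := by gcongr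
  have := le_of_mul_le_mul_left this hn0
  linarith

/-- The upper bound in Mertens' first theorem. -/
lemma primeLogSum_le {x : ℝ} (hx : 1 ≤ x) : primeLogSum x ≤ log x + log 4 := by
  set n := ⌊x⌋₊ with hn
  have hn1 : 1 ≤ n := Nat.one_le_floor_iff x |>.2 hx
  have hn0 : (0 : ℝ) < n := by exact_mod_cast hn1
  have hlog : log n ≤ log x := log_le_log hn0 (Nat.floor_le (by linarith))
  have hfac : log n.factorial ≤ n * log n := by
    rw [← log_pow]
    exact log_le_log (by positivity) (by exact_mod_cast Nat.factorial_le_pow n)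
  have htheta := Chebyshev.theta_le_log4_mul_x hn0.le
  rw [Chebyshev.theta_eq_sum_Icc, Nat.floor_natCast] at htheta
  have hIcc : Finset.Icc 0 n = Finset.Iic n := by ext; simp
  rw [hIcc] at htheta
  have hlow : n * primeLogSum x - ∑ p ∈ (Finset.Iic n).filter Nat.Prime, log p ≤
      log n.factorial := by
    rw [log_factorial_eq_sum_primes, primeLogSum, ← hn, Finset.mul_sum, ← Finset.sum_sub_distrib]
    refine Finset.sum_le_sum fun p hp => ?_
    have hp := (Finset.mem_filter.1 hp).2
    have hp2 : (2 : ℝ) ≤ p := by exact_mod_cast hp.two_le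
    have hv : (n : ℝ) / p - 1 ≤ n.factorial.factorization p := by
      have h1 : n / p ≤ n.factorial.factorization p := by
        rw [Nat.factorization_factorial hp (b := Nat.log p n + 2) (by omega)]
        calc n / p = n / p ^ 1 := by rw [pow_one]
          _ ≤ _ := Finset.single_le_sum (f := fun i => n / p ^ i)
            (fun _ _ => Nat.zero_le _) (by simp)
      have h2 : (n : ℝ) / p < (n / p : ℕ) + 1 := by
        rw [← Nat.floor_div_eq_div (K := ℝ)]
        exact Nat.lt_floor_add_one _
      have h3 : ((n / p : ℕ) : ℝ) ≤ n.factorial.factorization p := by exact_mod_cast h1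
      linarith
    calc n * (log p / p) - log p = (n / p - 1) * log p := by ring
      _ ≤ _ := by
          gcongr
  have : (n : ℝ) * primeLogSum x ≤ n * (log n + log 4) := by linarith
  have := le_of_mul_le_mul_left this hn0
  linarith

lemma hasDerivAt_inv_log {t : ℝ} (ht : 1 < t) :
    HasDerivAt (fun t => (log t)⁻¹) (-(t * log t ^ 2)⁻¹) t := by
  have := (hasDerivAt_log (by linarith : t ≠ 0)).fun_inv (log_pos ht).ne'
  exact this.congr_deriv (by rw [mul_inv, neg_div, div_eq_mul_inv])

lemma continuousOn_inv_mul_log_sq {a b : ℝ} (ha : 1 < a) :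
    ContinuousOn (fun t => (t * log t ^ 2)⁻¹) (Set.Icc a b) := by
  intro t ht
  have h1 : 1 < t := lt_of_lt_of_le ha ht.1
  have h0 : t ≠ 0 := by linarith
  have : t * log t ^ 2 ≠ 0 := mul_ne_zero h0 (pow_ne_zero _ (log_pos h1).ne')
  refine ContinuousAt.continuousWithinAt ?_
  fun_prop (disch := assumption)

lemma intervalIntegrable_inv_mul_log_sq_mul_primeLogSum {a b : ℝ} (ha : 1 < a) (hab : a ≤ b) :
    IntervalIntegrable (fun t => (t * log t ^ 2)⁻¹ * primeLogSum t) MeasureTheory.volume a b := by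
  rw [intervalIntegrable_iff_integrableOn_Icc_of_le hab]
  have := integrableOn_mul_sum_Icc (m := 0) (fun k : ℕ => if k.Prime then log k / k else 0)
    (by linarith : 0 ≤ a) (continuousOn_inv_mul_log_sq (b := b) ha).integrableOn_Icc
  refine this.congr_fun (fun t _ => ?_) measurableSet_Icc
  simp only [primeLogSum, Finset.sum_filter]
  congr 1

/-- Partial summation relating the sums of `1 / p` and of `log p / p`. -/
lemma primeInvSum_sub_eq {a b : ℝ} (ha : 1 < a) (hab : a ≤ b) :
    primeInvSum b - primeInvSum a = primeLogSum b / log b - primeLogSum a / log a +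
      ∫ t in a..b, (t * log t ^ 2)⁻¹ * primeLogSum t := by
  set c : ℕ → ℝ := fun k => if k.Prime then log k / k else 0 with hc
  have hA : ∀ t : ℝ, ∑ k ∈ Finset.Icc 0 ⌊t⌋₊, c k = primeLogSum t := fun t => by
    simp only [primeLogSum, Finset.sum_filter]
    rfl
  have hderiv : ∀ t ∈ Set.Icc a b, deriv (fun t => (log t)⁻¹) t = -(t * log t ^ 2)⁻¹ :=
    fun t ht => (hasDerivAt_inv_log (lt_of_lt_of_le ha ht.1)).deriv
  have key := sum_mul_eq_sub_sub_integral_mul c (f := fun t => (log t)⁻¹)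
    (by linarith : 0 ≤ a) hab
    (fun t ht => (hasDerivAt_inv_log (lt_of_lt_of_le ha ht.1)).differentiableAt)
    ((continuousOn_inv_mul_log_sq ha).neg.integrableOn_Icc.congr_fun
      (fun t ht => (hderiv t ht).symm) measurableSet_Icc)
  have hint : ∫ t in Set.Ioc a b, deriv (fun t => (log t)⁻¹) t * ∑ k ∈ Finset.Icc 0 ⌊t⌋₊, c k =
      -∫ t in a..b, (t * log t ^ 2)⁻¹ * primeLogSum t := by
    rw [intervalIntegral.integral_of_le hab, ← MeasureTheory.integral_neg]
    refine MeasureTheory.setIntegral_congr_fun measurableSet_Ioc fun t ht => ?_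
    simp only [hderiv t ⟨ht.1.le, ht.2⟩, hA, neg_mul]
  rw [hint, hA, hA] at key
  have hsum : ∑ k ∈ Finset.Ioc ⌊a⌋₊ ⌊b⌋₊, (log k)⁻¹ * c k = primeInvSum b - primeInvSum a := by
    have hU : Finset.Iic ⌊b⌋₊ = Finset.Iic ⌊a⌋₊ ∪ Finset.Ioc ⌊a⌋₊ ⌊b⌋₊ := by
      have := Nat.floor_mono hab
      ext k
      simp only [Finset.mem_Iic, Finset.mem_union, Finset.mem_Ioc]
      omega
    have hd : Disjoint (Finset.Iic ⌊a⌋₊) (Finset.Ioc ⌊a⌋₊ ⌊b⌋₊) := by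
      rw [Finset.disjoint_left]
      intro k
      simp only [Finset.mem_Iic, Finset.mem_Ioc]
      omega
    rw [primeInvSum, primeInvSum, Finset.sum_filter, Finset.sum_filter, hU,
      Finset.sum_union hd, add_sub_cancel_left]
    refine Finset.sum_congr rfl fun k _ => ?_
    simp only [hc]
    split_ifs with hk
    · have : log (k : ℝ) ≠ 0 := (log_pos (by exact_mod_cast hk.one_lt)).ne'
      field_simp
    · simp
  rw [← hsum, key]
  ring

lemma integral_inv_mul_log_sq_mul_log_add {a b : ℝ} (ha : 1 < a) (hab : a ≤ b) (k : ℝ) :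
    IntervalIntegrable (fun t => (t * log t ^ 2)⁻¹ * (log t + k)) MeasureTheory.volume a b ∧
    ∫ t in a..b, (t * log t ^ 2)⁻¹ * (log t + k) =
      (log (log b) - k / log b) - (log (log a) - k / log a) := by
  have hI : IntervalIntegrable (fun t => (t * log t ^ 2)⁻¹ * (log t + k))
      MeasureTheory.volume a b := by
    refine ContinuousOn.intervalIntegrable_of_Icc hab ((continuousOn_inv_mul_log_sq ha).mul ?_)
    refine (continuousOn_log.mono fun t ht => ?_).add continuousOn_const
    have := ht.1
    simp only [Set.mem_compl_iff, Set.mem_singleton_iff]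
    linarith
  refine ⟨hI, ?_⟩
  refine intervalIntegral.integral_eq_sub_of_hasDerivAt
    (f := fun t => log (log t) - k / log t) (fun t ht => ?_) hI
  rw [Set.uIcc_of_le hab] at ht
  have h1 : 1 < t := lt_of_lt_of_le ha ht.1
  have h0 : t ≠ 0 := by linarith
  have hl : log t ≠ 0 := (log_pos h1).ne'
  have := ((hasDerivAt_log h0).log hl).sub ((hasDerivAt_inv_log h1).const_mul k)
  simp only [div_eq_mul_inv]
  refine this.congr_deriv ?_
  field_simp
  ring

/-- The error function in Mertens' second theorem. -/
noncomputable def mertensDiff (x : ℝ) : ℝ := primeInvSum x - log (log x)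

lemma le_mertensDiff_sub {a b k : ℝ} (ha : 1 < a) (hab : a ≤ b)
    (h : ∀ t, 1 ≤ t → log t + k ≤ primeLogSum t) :
    -(primeLogSum a - log a - k) / log a ≤ mertensDiff b - mertensDiff a := by
  obtain ⟨hI, hval⟩ := integral_inv_mul_log_sq_mul_log_add ha hab k
  have hint : ∫ t in a..b, (t * log t ^ 2)⁻¹ * (log t + k) ≤
      ∫ t in a..b, (t * log t ^ 2)⁻¹ * primeLogSum t := by
    refine intervalIntegral.integral_mono_on hab hI
      (intervalIntegrable_inv_mul_log_sq_mul_primeLogSum ha hab) fun t ht => ?_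
    have h1 : 1 < t := lt_of_lt_of_le ha ht.1
    exact mul_le_mul_of_nonneg_left (h t h1.le) (by positivity)
  have hE := primeInvSum_sub_eq ha hab
  have hla : 0 < log a := log_pos ha
  have hlb : 0 < log b := log_pos (ha.trans_le hab)
  have hb : (log b + k) / log b ≤ primeLogSum b / log b := by
    gcongr
    exact h b (ha.le.trans hab)
  have e1 : (log b + k) / log b = 1 + k / log b := by field_simp
  have e2 : -(primeLogSum a - log a - k) / log a = -(primeLogSum a / log a) + 1 + k / log a := by
    field_simp
    ring
  simp only [mertensDiff]
  rw [e2]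
  linarith

lemma mertensDiff_sub_le {a b k : ℝ} (ha : 1 < a) (hab : a ≤ b)
    (h : ∀ t, 1 ≤ t → primeLogSum t ≤ log t + k) :
    mertensDiff b - mertensDiff a ≤ -(primeLogSum a - log a - k) / log a := by
  obtain ⟨hI, hval⟩ := integral_inv_mul_log_sq_mul_log_add ha hab k
  have hint : ∫ t in a..b, (t * log t ^ 2)⁻¹ * primeLogSum t ≤
      ∫ t in a..b, (t * log t ^ 2)⁻¹ * (log t + k) := by
    refine intervalIntegral.integral_mono_on hab
      (intervalIntegrable_inv_mul_log_sq_mul_primeLogSum ha hab) hI fun t ht => ?_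
    have h1 : 1 < t := lt_of_lt_of_le ha ht.1
    exact mul_le_mul_of_nonneg_left (h t h1.le) (by positivity)
  have hE := primeInvSum_sub_eq ha hab
  have hla : 0 < log a := log_pos ha
  have hlb : 0 < log b := log_pos (ha.trans_le hab)
  have hb : primeLogSum b / log b ≤ (log b + k) / log b := by
    gcongr
    exact h b (ha.le.trans hab)
  have e1 : (log b + k) / log b = 1 + k / log b := by field_simp
  have e2 : -(primeLogSum a - log a - k) / log a = -(primeLogSum a / log a) + 1 + k / log a := by
    field_simp
    ring
  simp only [mertensDiff]
  rw [e2]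
  linarith

lemma abs_mertensDiff_sub_le {a b : ℝ} (ha : 1 < a) (hab : a ≤ b) :
    |mertensDiff b - mertensDiff a| ≤ 4 / log a := by
  have hl : log 4 ≤ 9 / 5 := by
    have : log 4 = 2 * log 2 := by
      rw [show (4 : ℝ) = 2 ^ 2 by norm_num, log_pow]
      norm_num
    linarith [log_two_lt_d9]
  have hlow := le_mertensDiff_sub (k := -(11 / 5)) ha hab
    fun t ht => by linarith [log_sub_le_primeLogSum ht]
  have hup := mertensDiff_sub_le (k := log 4) ha hab fun t ht => primeLogSum_le ht
  have hla : 0 < log a := log_pos ha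
  rw [abs_le]
  constructor
  · refine le_trans ?_ hlow
    rw [← neg_div]
    gcongr
    linarith [primeLogSum_le ha.le]
  · refine hup.trans ?_
    gcongr
    linarith [log_sub_le_primeLogSum ha.le]

lemma floor_exp_four : ⌊exp 4⌋₊ = 54 := by
  have h : exp 4 = exp 1 ^ 4 := by rw [exp_one_pow]; norm_num
  rw [Nat.floor_eq_iff (exp_pos _).le, h]
  constructor
  · calc ((54 : ℕ) : ℝ) ≤ 2.718 ^ 4 := by norm_num
      _ ≤ exp 1 ^ 4 := by gcongr; exact (lt_trans (by norm_num) exp_one_gt_d9).le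
  · calc exp 1 ^ 4 ≤ 2.719 ^ 4 := by gcongr; exact (exp_one_lt_d9.trans (by norm_num)).le
      _ < _ := by norm_num

set_option maxRecDepth 10000 in
lemma filter_prime_Iic_54 : (Finset.Iic 54).filter Nat.Prime =
    {2, 3, 5, 7, 11, 13, 17, 19, 23, 29, 31, 37, 41, 43, 47, 53} := by
  decide

lemma primeLogSum_exp_four_le : primeLogSum (exp 4) ≤ 2.88 := by
  rw [primeLogSum, floor_exp_four, filter_prime_Iic_54]
  have bound (p a : ℕ) (hp : 0 < p) (h : (p : ℝ) ^ 50 ≤ 2.7182 ^ a) : log (p : ℝ) ≤ a / 50 := by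
    simpa using log_le_of_pow_le (by exact_mod_cast hp) a 50 (by norm_num) h
  have h2 := bound 2 35 (by norm_num) (by norm_num)
  have h3 := bound 3 55 (by norm_num) (by norm_num)
  have h5 := bound 5 81 (by norm_num) (by norm_num)
  have h7 := bound 7 98 (by norm_num) (by norm_num)
  have h11 := bound 11 120 (by norm_num) (by norm_num)
  have h13 := bound 13 129 (by norm_num) (by norm_num)
  have h17 := bound 17 142 (by norm_num) (by norm_num)
  have h19 := bound 19 148 (by norm_num) (by norm_num)
  have h23 := bound 23 157 (by norm_num) (by norm_num)
  have h29 := bound 29 169 (by norm_num) (by norm_num)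
  have h31 := bound 31 172 (by norm_num) (by norm_num)
  have h37 := bound 37 181 (by norm_num) (by norm_num)
  have h41 := bound 41 186 (by norm_num) (by norm_num)
  have h43 := bound 43 189 (by norm_num) (by norm_num)
  have h47 := bound 47 193 (by norm_num) (by norm_num)
  have h53 := bound 53 199 (by norm_num) (by norm_num)
  simp only [Finset.sum_insert, Finset.mem_insert, Finset.mem_singleton, Finset.sum_singleton,
    Nat.reduceEqDiff, or_self, not_false_eq_true]
  push_cast at *
  linarith

lemma mertensDiff_exp_four_ge : 0.29 ≤ mertensDiff (exp 4) := by
  rw [mertensDiff, primeInvSum, floor_exp_four, filter_prime_Iic_54, log_exp,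
    show (4 : ℝ) = 2 ^ 2 by norm_num, log_pow]
  have := log_two_lt_d9
  norm_num
  linarith

lemma le_mertensDiff {x : ℝ} (hx : exp 4 ≤ x) : 0.01 ≤ mertensDiff x := by
  have hlow := le_mertensDiff_sub (k := -(11 / 5)) (by simp : 1 < exp 4) hx
    fun t ht => by linarith [log_sub_le_primeLogSum ht]
  rw [log_exp] at hlow
  linarith [mertensDiff_exp_four_ge, primeLogSum_exp_four_le]

/-- Mertens' second theorem: there are constants `C` and `K > 0` such that for all
`x ≥ 2`, `|∑_{p ≤ x} 1/p − log log x − C| ≤ K / log x`. -/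
theorem mertens_second :
    ∃ C : ℝ, 0 < C ∧ ∃ K : ℝ, 0 < K ∧ ∀ x : ℝ, 2 ≤ x →
      |(∑ p ∈ (Finset.Iic ⌊x⌋₊).filter Nat.Prime, (1 : ℝ) / p)
        - Real.log (Real.log x) - C| ≤ K / Real.log x := by
  have htop : Filter.Tendsto (fun n : ℕ => (n : ℝ) + 2) Filter.atTop Filter.atTop :=
    Filter.tendsto_atTop_add_const_right _ _ tendsto_natCast_atTop_atTop
  have hcauchy : CauchySeq fun n : ℕ => mertensDiff (n + 2) := by
    refine cauchySeq_of_le_tendsto_0' (fun n : ℕ => 4 / log ((n : ℝ) + 2)) (fun n m hnm => ?_) ?_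
    · rw [dist_comm, dist_eq]
      refine abs_mertensDiff_sub_le (by linarith [n.cast_nonneg (α := ℝ)]) ?_
      gcongr
    · exact (tendsto_log_atTop.comp htop).const_div_atTop 4
  obtain ⟨C, hC⟩ := cauchySeq_tendsto_of_complete hcauchy
  refine ⟨C, ?_, 4, by norm_num, fun x hx => ?_⟩
  · have : 0.01 ≤ C := ge_of_tendsto hC <| by
      filter_upwards [htop.eventually_ge_atTop (exp 4)] with n hn using le_mertensDiff hn
    linarith
  · change |mertensDiff x - C| ≤ 4 / log x
    rw [abs_sub_comm]
    refine le_of_tendsto (hC.sub_const (mertensDiff x)).abs ?_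
    filter_upwards [htop.eventually_ge_atTop x] with n hn
    exact abs_mertensDiff_sub_le (by linarith) hn
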